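/- arXiv:2601.09643 — 4 statements merged into one kernel-verified Lean document; each statement's English description precedes it below -/
import Mathlib

section
/- Let G be a locally finite group, let φ be an endomorphism of G, and let N be a φ-invariant subgroup of G contained in the center Z(G). Then h(φ) ≤ h(φ↾_N) + h(φ̄), where φ̄ is the endomorphism induced by φ on G/N. -/
open scoped Pointwise ENNReal

/-- A group is *locally finite* if every finitely generated subgroup is finite. -/
def IsLocallyFinite (G : Type*) [Group G] : Prop :=
  ∀ S : Set G, S.Finite → (Subgroup.closure S : Set G).Finite

namespace AlgEntropy

variable {G : Type*} [Group G]

/-- `entTraj φ F n` is the `n`-th trajectory `T_n(φ,F) = F·φ(F)···φ^{n-1}(F)`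
(with `T_0 = {1}`). -/
def entTraj (φ : G →* G) (F : Set G) : ℕ → Set G
  | 0 => {1}
  | n + 1 => entTraj φ F n * (⇑φ)^[n] '' F

/-- The algebraic entropy of `φ` with respect to a subgroup `F`:
`H(φ,F) = lim_n (1/n)·log|T_n(φ,F)|` (the limit exists when `G` is locally
finite and `F` is finite, and then it coincides with this `limsup`). -/
noncomputable def entH (φ : G →* G) (F : Subgroup G) : ℝ :=
  Filter.limsup (fun n : ℕ => Real.log (entTraj φ (F : Set G) n).ncard / n) Filter.atTop

/-- The algebraic entropy `h(φ) = sup { H(φ,F) : F ≤ G finite }`, valued in `[0,∞]`. -/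
noncomputable def algEnt (φ : G →* G) : ℝ≥0∞ :=
  ⨆ (F : Subgroup G) (_ : (F : Set G).Finite), ENNReal.ofReal (entH φ F)

/-- The restriction of an endomorphism `φ` to a `φ`-invariant subgroup `H`. -/
def endRestrict (φ : G →* G) (H : Subgroup G) (hH : H ≤ H.comap φ) : H →* H :=
  (φ.domRestrict H).codRestrict H (fun x => hH x.2)

/-- The entropy of the endomorphism induced by `φ` on the quotient `G ⧸ H`. -/
noncomputable def entQuot (φ : G →* G) (H : Subgroup G) (hN : H.Normal)
    (hH : H ≤ H.comap φ) : ℝ≥0∞ :=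
  letI := hN
  algEnt (QuotientGroup.map H H φ hH)

/-- The Addition Theorem `AT(G,φ,H)`:
`h(φ) = h(φ↾_H) + h(φ̄)` where `φ̄` is induced by `φ` on `G ⧸ H`. -/
def AT (φ : G →* G) (H : Subgroup G) (hN : H.Normal) (hH : H ≤ H.comap φ) : Prop :=
  algEnt φ = algEnt (endRestrict φ H hH) + entQuot φ H hN hH

lemma commutator_le_comap (φ : G →* G) :
    commutator G ≤ (commutator G).comap φ := by
  rw [← Subgroup.map_le_iff_le_comap]
  calc Subgroup.map φ (commutator G) = ⁅Subgroup.map φ ⊤, Subgroup.map φ ⊤⁆ :=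
        Subgroup.map_commutator ⊤ ⊤ φ
    _ ≤ commutator G := Subgroup.commutator_mono le_top le_top

lemma normal_of_le_center {N : Subgroup G} (h : N ≤ Subgroup.center G) : N.Normal := by
  constructor
  intro n hn g
  have hc := Subgroup.mem_center_iff.mp (h hn) g
  have : g * n * g⁻¹ = n := by
    rw [hc]; group
  rwa [this]

lemma center_le_comap_equiv (φ : G ≃* G) :
    Subgroup.center G ≤ (Subgroup.center G).comap φ.toMonoidHom := by
  intro x hx
  simp only [Subgroup.mem_comap]
  refine Subgroup.mem_center_iff.mpr fun g => ?_
  have hg : φ (φ.symm g) = g := φ.apply_symm_apply g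
  calc g * φ x = φ (φ.symm g) * φ x := by rw [hg]
    _ = φ (φ.symm g * x) := by rw [map_mul]
    _ = φ (x * φ.symm g) := by rw [Subgroup.mem_center_iff.mp hx (φ.symm g)]
    _ = φ x * g := by rw [map_mul, hg]

lemma lowerCentralSeries_le_comap (φ : G →* G) (n : ℕ) :
    Subgroup.lowerCentralSeries (⊤ : Subgroup G) n ≤
      (Subgroup.lowerCentralSeries (⊤ : Subgroup G) n).comap φ := by
  rw [← Subgroup.map_le_iff_le_comap]
  induction n with
  | zero => exact le_top
  | succ n ih =>
      show Subgroup.map φ ⁅Subgroup.lowerCentralSeries (⊤ : Subgroup G) n, ⊤⁆ ≤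
          ⁅Subgroup.lowerCentralSeries (⊤ : Subgroup G) n, ⊤⁆
      rw [Subgroup.map_commutator]
      exact Subgroup.commutator_mono ih le_top

lemma upperCentralSeries_le_comap (φ : G ≃* G) (n : ℕ) :
    upperCentralSeries G n ≤ (upperCentralSeries G n).comap φ.toMonoidHom := by
  have := comap_upperCentralSeries φ n
  -- `(upperCentralSeries G n).comap φ = upperCentralSeries G n`
  exact le_of_eq this.symm

end AlgEntropy

namespace AlgEntropy

lemma entTraj_image {G H : Type*} [Group G] [Group H] (φ : G →* G) (φ' : H →* H) (ψ : G →* H)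
    (h : ∀ x, ψ (φ x) = φ' (ψ x)) (F : Set G) (n : ℕ) :
    ψ '' entTraj φ F n = entTraj φ' (ψ '' F) n := by
  have h2 : ∀ n x, ψ ((⇑φ)^[n] x) = (⇑φ')^[n] (ψ x) := by
    intro n
    induction n with
    | zero => intro x; rfl
    | succ n ih => intro x; rw [Function.iterate_succ_apply, Function.iterate_succ_apply, ih, h]
  induction n with
  | zero => simp [entTraj]
  | succ n ih =>
    simp only [entTraj]
    rw [Set.image_mul, ih, Set.image_image, Set.image_image]
    simp only [h2]

lemma iter_image_mul {G : Type*} [Group G] (φ : G →* G) (n : ℕ) (A B : Set G) :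
    (⇑φ)^[n] '' (A * B) = (⇑φ)^[n] '' A * (⇑φ)^[n] '' B := by
  induction n with
  | zero => simp
  | succ n ih =>
    rw [Function.iterate_succ', Set.image_comp, ih, Set.image_mul, Set.image_comp, Set.image_comp]

lemma entTraj_add {G : Type*} [Group G] (φ : G →* G) (F : Set G) (n m : ℕ) :
    entTraj φ F (n + m) = entTraj φ F n * (⇑φ)^[n] '' entTraj φ F m := by
  induction m with
  | zero => simp [entTraj, iterate_map_one]
  | succ m ih =>
    rw [← add_assoc]
    simp only [entTraj]
    rw [ih, iter_image_mul, mul_assoc, Function.iterate_add, Set.image_comp]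

lemma entTraj_finite {G : Type*} [Group G] (φ : G →* G) {F : Set G} (hF : F.Finite) (n : ℕ) :
    (entTraj φ F n).Finite := by
  induction n with
  | zero => simp [entTraj]
  | succ n ih => exact ih.mul (hF.image _)

lemma one_mem_entTraj {G : Type*} [Group G] (φ : G →* G) (F : Subgroup G) (n : ℕ) :
    (1 : G) ∈ entTraj φ (F : Set G) n := by
  induction n with
  | zero => simp [entTraj]
  | succ n ih => exact ⟨1, ih, 1, ⟨1, F.one_mem, iterate_map_one φ n⟩, by simp⟩

lemma ncard_mul_le {G : Type*} [Group G] {A B : Set G} :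
    (A * B).ncard ≤ A.ncard * B.ncard := by
  exact Set.natCard_mul_le

lemma ncard_entTraj_add_le {G : Type*} [Group G] (φ : G →* G) {F : Set G} (hF : F.Finite)
    (n m : ℕ) : (entTraj φ F (n + m)).ncard ≤ (entTraj φ F n).ncard * F.ncard ^ m := by
  induction m with
  | zero => simp
  | succ m ih =>
    rw [← add_assoc, pow_succ, ← mul_assoc]
    exact ncard_mul_le.trans (Nat.mul_le_mul ih (Set.ncard_image_le hF))

lemma ncard_entTraj_pos {G : Type*} [Group G] (φ : G →* G) (F : Subgroup G)
    (hF : (F : Set G).Finite) (n : ℕ) : 0 < (entTraj φ (F : Set G) n).ncard :=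
  (Set.ncard_pos (entTraj_finite φ hF n)).2 ⟨1, one_mem_entTraj φ F n⟩

lemma ncard_entTraj_mono {G : Type*} [Group G] (φ : G →* G) (F : Subgroup G)
    (hF : (F : Set G).Finite) {n m : ℕ} (h : n ≤ m) :
    (entTraj φ (F : Set G) n).ncard ≤ (entTraj φ (F : Set G) m).ncard := by
  obtain ⟨k, rfl⟩ := Nat.exists_eq_add_of_le h
  refine Set.ncard_le_ncard ?_ (entTraj_finite φ hF _)
  rw [entTraj_add]
  intro x hx
  exact ⟨x, hx, 1, ⟨1, one_mem_entTraj φ F k, iterate_map_one φ n⟩, by simp⟩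

lemma log_entTraj_bound {G : Type*} [Group G] (φ : G →* G) (F : Subgroup G)
    (hF : (F : Set G).Finite) (n : ℕ) :
    Real.log (entTraj φ (F : Set G) n).ncard / n ≤ Real.log (F : Set G).ncard := by
  have h0 : 0 ≤ Real.log (F : Set G).ncard := Real.log_natCast_nonneg _
  refine div_le_of_le_mul₀ (Nat.cast_nonneg _) h0 ?_
  have h1 := ncard_entTraj_add_le φ hF 0 n
  simp only [zero_add, entTraj, Set.ncard_singleton, one_mul] at h1
  rw [mul_comm, ← Real.log_pow]
  exact Real.log_le_log (by exact_mod_cast ncard_entTraj_pos φ F hF n) (by exact_mod_cast h1)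

lemma eventually_lt_entH {G : Type*} [Group G] (φ : G →* G) (F : Subgroup G)
    (hF : (F : Set G).Finite) {ε : ℝ} (hε : 0 < ε) :
    ∀ᶠ n : ℕ in Filter.atTop,
      Real.log (entTraj φ (F : Set G) n).ncard / n < entH φ F + ε := by
  refine Filter.eventually_lt_of_limsup_lt (lt_add_of_pos_right _ hε) ?_
  exact Filter.isBoundedUnder_of ⟨_, log_entTraj_bound φ F hF⟩

lemma entH_le_of_eventually {G : Type*} [Group G] (φ : G →* G) (F : Subgroup G) {c : ℝ}
    (h : ∀ᶠ n : ℕ in Filter.atTop, Real.log (entTraj φ (F : Set G) n).ncard / n ≤ c) :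
    entH φ F ≤ c := by
  refine Filter.limsup_le_of_le ?_ h
  exact Filter.IsCoboundedUnder.of_frequently_ge (a := 0)
    (Filter.Frequently.of_forall fun n =>
      div_nonneg (Real.log_natCast_nonneg _) (Nat.cast_nonneg _))

lemma entTraj_central_subset {G : Type*} [Group G] (φ : G →* G) (F : Set G) (S : Set G)
    (C : Subgroup G) (m : ℕ) (hm : 0 < m) (hS : S.Finite)
    (hC : ∀ n, ∀ x ∈ entTraj φ (C : Set G) n, x ∈ Subgroup.center G)
    (hsub : entTraj φ F m ⊆ S * (C : Set G)) (q : ℕ) :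
    ∃ S' : Set G, S'.Finite ∧ S'.ncard ≤ S.ncard ^ q ∧
      entTraj φ F (q * m) ⊆ S' * entTraj φ (C : Set G) (q * m) := by
  induction q with
  | zero => exact ⟨{1}, by simp, by simp, by simp [entTraj]⟩
  | succ q ih =>
    obtain ⟨S', h1, h2, h3⟩ := ih
    refine ⟨S' * (⇑φ)^[q * m] '' S, h1.mul (hS.image _), ?_, ?_⟩
    · rw [pow_succ]
      exact ncard_mul_le.trans (Nat.mul_le_mul h2 (Set.ncard_image_le hS))
    · rw [Nat.succ_mul, entTraj_add, entTraj_add]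
      rintro _ ⟨x, hx, _, ⟨y, hy, rfl⟩, rfl⟩
      obtain ⟨s', hs', c', hc', rfl⟩ := h3 hx
      obtain ⟨s, hs, c, hc, rfl⟩ := hsub hy
      refine ⟨s' * (⇑φ)^[q * m] s, ⟨s', hs', _, ⟨s, hs, rfl⟩, rfl⟩,
        c' * (⇑φ)^[q * m] c, ⟨c', hc', _, ⟨c, ?_, rfl⟩, rfl⟩, ?_⟩
      · obtain ⟨k, rfl⟩ := Nat.exists_eq_add_of_le hm
        rw [entTraj_add]
        exact ⟨c, ⟨1, by simp [entTraj], c, ⟨c, hc, rfl⟩, by simp⟩, 1,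
          ⟨1, one_mem_entTraj φ C k, iterate_map_one φ _⟩, by simp⟩
      · have := Subgroup.mem_center_iff.mp (hC _ _ hc') ((⇑φ)^[q * m] s)
        simp only [iterate_map_mul]
        rw [mul_assoc, ← mul_assoc ((⇑φ)^[q * m] s), this]
        simp only [mul_assoc]

lemma exists_central {G : Type*} [Group G] (hG : IsLocallyFinite G) (φ : G →* G)
    (N : Subgroup G) [N.Normal] (hc : N ≤ Subgroup.center G) (hφ : N ≤ N.comap φ)
    (F : Subgroup G) (hF : (F : Set G).Finite) (m : ℕ) (hm : 0 < m) :
    ∃ D : Subgroup N, (D : Set N).Finite ∧ ∀ q,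
      (entTraj φ (F : Set G) (q * m)).ncard ≤
        (entTraj (QuotientGroup.map N N φ hφ)
          ((F.map (QuotientGroup.mk' N) : Subgroup (G ⧸ N)) : Set (G ⧸ N)) m).ncard ^ q *
        (entTraj (endRestrict φ N hφ) (D : Set N) (q * m)).ncard := by
  set T := entTraj φ (F : Set G) m with hT
  have hTf : T.Finite := entTraj_finite φ hF m
  have hq : (QuotientGroup.mk' N) '' T = entTraj (QuotientGroup.map N N φ hφ)
          ((F.map (QuotientGroup.mk' N) : Subgroup (G ⧸ N)) : Set (G ⧸ N)) m := by
    rw [Subgroup.coe_map]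
    exact entTraj_image φ _ (QuotientGroup.mk' N) (fun x => rfl) _ m
  obtain ⟨S, hST, hbij⟩ := (Set.surjOn_image (QuotientGroup.mk' N) T).exists_bijOn_subset
  have hSf : S.Finite := hTf.subset hST
  let X : Set N := {x | (x : G) ∈ T⁻¹ * T}
  let D : Subgroup N := Subgroup.closure X
  have hXf : (N.subtype '' X).Finite := (hTf.inv.mul hTf).subset (by
    rintro _ ⟨x, hx, rfl⟩; exact hx)
  have hDf : (D : Set N).Finite := by
    have h1 := hG _ hXf
    rw [← MonoidHom.map_closure, Subgroup.coe_map] at h1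
    exact h1.of_finite_image N.subtype_injective.injOn
  have himg : ∀ n, N.subtype '' entTraj (endRestrict φ N hφ) (D : Set N) n =
      entTraj φ ((D.map N.subtype : Subgroup G) : Set G) n := by
    intro n
    rw [Subgroup.coe_map]
    exact entTraj_image _ φ N.subtype (fun x => rfl) _ n
  have hsub : T ⊆ S * ((D.map N.subtype : Subgroup G) : Set G) := by
    intro t ht
    obtain ⟨s, hs, hst⟩ := hbij.surjOn ⟨t, ht, rfl⟩
    have hmem : s⁻¹ * t ∈ N := QuotientGroup.eq.mp hst
    refine ⟨s, hs, s⁻¹ * t, ?_, by simp⟩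
    refine ⟨⟨s⁻¹ * t, hmem⟩, Subgroup.subset_closure ?_, rfl⟩
    exact ⟨s⁻¹, by simpa using hST hs, t, ht, rfl⟩
  refine ⟨D, hDf, fun q => ?_⟩
  obtain ⟨S', h1, h2, h3⟩ := entTraj_central_subset φ (F : Set G) S (D.map N.subtype) m hm hSf
    (by
      intro n x hx
      rw [← himg] at hx
      obtain ⟨y, _, rfl⟩ := hx
      exact hc y.2) hsub q
  rw [← himg] at h3
  have hcard : S.ncard = ((QuotientGroup.mk' N) '' T).ncard := by
    rw [← hbij.image_eq, Set.ncard_image_of_injOn hbij.injOn]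
  rw [← hq, ← hcard]
  refine (Set.ncard_le_ncard h3 (h1.mul ((entTraj_finite _ hDf _).image _))).trans ?_
  refine ncard_mul_le.trans (Nat.mul_le_mul h2 ?_)
  exact Set.ncard_image_le (entTraj_finite _ hDf _)

lemma entH_le_central {G : Type*} [Group G] (hG : IsLocallyFinite G) (φ : G →* G)
    (N : Subgroup G) [N.Normal] (hc : N ≤ Subgroup.center G) (hφ : N ≤ N.comap φ)
    (F : Subgroup G) (hF : (F : Set G).Finite) {ε : ℝ} (hε : 0 < ε) :
    ∃ D : Subgroup N, (D : Set N).Finite ∧ entH φ F ≤ entH (endRestrict φ N hφ) D +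
      entH (QuotientGroup.map N N φ hφ) (F.map (QuotientGroup.mk' N)) + 3 * ε := by
  set F' := F.map (QuotientGroup.mk' N) with hF'
  have hF'f : (F' : Set (G ⧸ N)).Finite := by
    rw [hF', Subgroup.coe_map]; exact hF.image _
  obtain ⟨m, hmlt, hm⟩ := ((eventually_lt_entH (QuotientGroup.map N N φ hφ) F' hF'f hε).and
    (Filter.eventually_gt_atTop 0)).exists
  obtain ⟨D, hD, hDq⟩ := exists_central hG φ N hc hφ F hF m hm
  refine ⟨D, hD, entH_le_of_eventually φ F ?_⟩
  set L := Real.log (F : Set G).ncard with hL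
  have hL0 : 0 ≤ L := Real.log_natCast_nonneg _
  have hlim : ∀ᶠ n : ℕ in Filter.atTop, (m * L) / n < ε :=
    (tendsto_const_div_atTop_nhds_zero_nat (m * L)).eventually_lt_const hε
  filter_upwards [eventually_lt_entH (endRestrict φ N hφ) D hD hε, hlim,
    Filter.eventually_gt_atTop 0] with n h1 h2 hn
  set a := Real.log (entTraj (QuotientGroup.map N N φ hφ) (F' : Set (G ⧸ N)) m).ncard with ha
  set c := Real.log (entTraj (endRestrict φ N hφ) (D : Set N) n).ncard with hcdef
  have ha0 : 0 ≤ a := Real.log_natCast_nonneg _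
  have hmR : (0 : ℝ) < m := by exact_mod_cast hm
  have hnR : (0 : ℝ) < n := by exact_mod_cast hn
  have key : (entTraj φ (F : Set G) n).ncard ≤
      (entTraj (QuotientGroup.map N N φ hφ) (F' : Set (G ⧸ N)) m).ncard ^ (n / m) *
      (entTraj (endRestrict φ N hφ) (D : Set N) n).ncard * (F : Set G).ncard ^ m := by
    have e : n / m * m + n % m = n := Nat.div_add_mod' n m
    calc (entTraj φ (F : Set G) n).ncard
        = (entTraj φ (F : Set G) (n / m * m + n % m)).ncard := by rw [e]
      _ ≤ (entTraj φ (F : Set G) (n / m * m)).ncard * (F : Set G).ncard ^ (n % m) :=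
          ncard_entTraj_add_le φ hF _ _
      _ ≤ _ := by
          refine Nat.mul_le_mul ((hDq _).trans (Nat.mul_le_mul le_rfl ?_)) ?_
          · exact ncard_entTraj_mono _ D hD (Nat.div_mul_le_self n m)
          · exact Nat.pow_le_pow_right ((Set.ncard_pos hF).2 ⟨1, F.one_mem⟩)
              (Nat.mod_lt n hm).le
  have p1 := ncard_entTraj_pos φ F hF n
  have p2 := ncard_entTraj_pos (QuotientGroup.map N N φ hφ) F' hF'f m
  have p3 := ncard_entTraj_pos (endRestrict φ N hφ) D hD n
  have p4 : 0 < (F : Set G).ncard := (Set.ncard_pos hF).2 ⟨1, F.one_mem⟩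
  have hlog : Real.log (entTraj φ (F : Set G) n).ncard ≤ (n / m : ℕ) * a + c + m * L := by
    have := Real.log_le_log (by exact_mod_cast p1) (Nat.cast_le (α := ℝ).2 key)
    push_cast at this
    rwa [Real.log_mul (by positivity) (by positivity), Real.log_mul (by positivity)
      (by positivity), Real.log_pow, Real.log_pow] at this
  have hdiv : ((n / m : ℕ) : ℝ) * a ≤ n * (a / m) := by
    have := mul_le_mul_of_nonneg_right (Nat.cast_div_le (α := ℝ) (m := n) (n := m)) ha0
    calc _ ≤ _ := this
      _ = _ := by ring
  have : Real.log (entTraj φ (F : Set G) n).ncard / n ≤ a / m + c / n + m * L / n := by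
    rw [div_le_iff₀ hnR]
    have : (a / m + c / n + m * L / n) * n = n * (a / m) + c + m * L := by
      field_simp
    linarith
  linarith

end AlgEntropy

/-- Subadditivity for central extensions. If `N` is a `φ`-invariant
subgroup of the locally finite group `G` contained in the center, then
`h(φ) ≤ h(φ↾_N) + h(φ̄)`. -/
theorem algEnt_le_central {G : Type*} [Group G] (hG : IsLocallyFinite G) (φ : G →* G)
    (N : Subgroup G) (hc : N ≤ Subgroup.center G) (hφ : N ≤ N.comap φ) :
    AlgEntropy.algEnt φ ≤
      AlgEntropy.algEnt (AlgEntropy.endRestrict φ N hφ) +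
        AlgEntropy.entQuot φ N (AlgEntropy.normal_of_le_center hc) hφ := by
  have := AlgEntropy.normal_of_le_center hc
  refine iSup₂_le fun F hF => ?_
  refine ENNReal.le_of_forall_pos_le_add fun ε hε _ => ?_
  have hε' : (0 : ℝ) < ε / 3 := by positivity
  obtain ⟨D, hD, h⟩ := AlgEntropy.entH_le_central hG φ N hc hφ F hF hε'
  have hF' : ((F.map (QuotientGroup.mk' N) : Subgroup (G ⧸ N)) : Set (G ⧸ N)).Finite := by
    rw [Subgroup.coe_map]; exact hF.image _
  refine (ENNReal.ofReal_le_ofReal h).trans ?_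
  refine ENNReal.ofReal_add_le.trans (add_le_add (ENNReal.ofReal_add_le.trans
    (add_le_add ?_ ?_)) ?_)
  · exact le_iSup₂ (f := fun (F : Subgroup N) (_ : (F : Set N).Finite) =>
      ENNReal.ofReal (AlgEntropy.entH (AlgEntropy.endRestrict φ N hφ) F)) D hD
  · exact le_iSup₂ (f := fun (F : Subgroup (G ⧸ N)) (_ : (F : Set (G ⧸ N)).Finite) =>
      ENNReal.ofReal (AlgEntropy.entH (QuotientGroup.map N N φ hφ) F)) _ hF'
  · rw [show 3 * ((ε : ℝ) / 3) = ε by ring, ENNReal.ofReal_coe_nnreal]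
end

section
/- Let G be a locally finite group and let φ be an automorphism of G. Then h(φ) = h(φ↾_{Z(G)}) + h(φ̄), where Z(G) is the center of G and φ̄ is the automorphism induced by φ on G/Z(G). -/
open scoped Pointwise ENNReal

namespace AlgEntropy

section aux

variable {G : Type*} [Group G] {Q : Type*} [Group Q]

lemma aux_traj_add (φ : G →* G) (F : Set G) (m n : ℕ) :
    entTraj φ F (m + n) = entTraj φ F m * (⇑φ)^[m] '' entTraj φ F n := by
  induction n with
  | zero =>
    have h1 : (⇑φ)^[m] 1 = 1 := by
      exact iterate_map_one φ _
    simp [entTraj, h1]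
  | succ n ih =>
    rw [← add_assoc]
    show entTraj φ F (m + n) * (⇑φ)^[m + n] '' F = _ * (⇑φ)^[m] '' (entTraj φ F n * (⇑φ)^[n] '' F)
    have h2 : (⇑φ)^[m] '' (entTraj φ F n * (⇑φ)^[n] '' F)
        = (⇑φ)^[m] '' entTraj φ F n * (⇑φ)^[m] '' ((⇑φ)^[n] '' F) :=
      Set.image_image2_distrib (iterate_map_mul φ m)
    rw [ih, h2, mul_assoc, Function.iterate_add, Set.image_comp]

lemma aux_traj_finite (φ : G →* G) {F : Set G} (hF : F.Finite) (n : ℕ) :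
    (entTraj φ F n).Finite := by
  induction n with
  | zero => exact Set.finite_singleton _
  | succ n ih => exact ih.mul (hF.image _)

lemma aux_traj_one_mem (φ : G →* G) {F : Set G} (hF : (1 : G) ∈ F) (n : ℕ) :
    (1 : G) ∈ entTraj φ F n := by
  induction n with
  | zero => exact Set.mem_singleton _
  | succ n ih =>
    refine ⟨1, ih, 1, ⟨1, hF, ?_⟩, mul_one _⟩
    exact iterate_map_one φ _

lemma aux_traj_mono (φ : G →* G) {F F' : Set G} (h : F ⊆ F') (n : ℕ) :
    entTraj φ F n ⊆ entTraj φ F' n := by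
  induction n with
  | zero => exact subset_rfl
  | succ n ih => exact Set.mul_subset_mul ih (Set.image_mono h)

lemma aux_traj_image (φ : G →* G) (ψ : Q →* Q) (f : G →* Q) (h : ∀ x, f (φ x) = ψ (f x))
    (F : Set G) (n : ℕ) : f '' entTraj φ F n = entTraj ψ (f '' F) n := by
  induction n with
  | zero => simp [entTraj]
  | succ n ih =>
    show f '' (entTraj φ F n * (⇑φ)^[n] '' F) = entTraj ψ (f '' F) n * (⇑ψ)^[n] '' (f '' F)
    have hs : Function.Semiconj f φ ψ := h
    rw [Set.image_mul, ih, ← Set.image_comp, ← Set.image_comp, (hs.iterate_right n).comp_eq]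

lemma aux_ncard_mul (A B : Set G) : (A * B).ncard ≤ A.ncard * B.ncard := by
  rw [← Nat.card_coe_set_eq, ← Nat.card_coe_set_eq, ← Nat.card_coe_set_eq]
  exact Set.natCard_mul_le

lemma aux_ncard_pos (φ : G →* G) {F : Set G} (hF : F.Finite) (h1 : (1 : G) ∈ F) (n : ℕ) :
    0 < (entTraj φ F n).ncard :=
  (Set.ncard_pos (aux_traj_finite φ hF n)).2 ⟨1, aux_traj_one_mem φ h1 n⟩

lemma aux_subadd (φ : G →* G) {F : Set G} (hF : F.Finite) (h1 : (1 : G) ∈ F) :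
    Subadditive (fun n => Real.log (entTraj φ F n).ncard) := by
  intro m n
  have hm := aux_ncard_pos φ hF h1 m
  have hn := aux_ncard_pos φ hF h1 n
  have hmn := aux_ncard_pos φ hF h1 (m + n)
  show Real.log _ ≤ Real.log _ + Real.log _
  rw [← Real.log_mul (by positivity) (by positivity)]
  apply Real.log_le_log (by positivity)
  rw [aux_traj_add]
  exact_mod_cast (aux_ncard_mul _ _).trans
    (Nat.mul_le_mul_left _ (Set.ncard_image_le (aux_traj_finite φ hF n)))

lemma aux_tendsto (φ : G →* G) (F : Subgroup G) (hF : (F : Set G).Finite) :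
    Filter.Tendsto (fun n : ℕ => Real.log (entTraj φ (F : Set G) n).ncard / n) Filter.atTop
      (nhds (entH φ F)) := by
  have h := (aux_subadd φ hF F.one_mem).tendsto_lim
    ⟨0, by rintro _ ⟨n, rfl⟩; exact div_nonneg (Real.log_natCast_nonneg _) (Nat.cast_nonneg _)⟩
  have h2 : entH φ F = _ := h.limsup_eq
  rw [h2]; exact h

lemma aux_nonneg (φ : G →* G) (F : Subgroup G) (hF : (F : Set G).Finite) : 0 ≤ entH φ F :=
  ge_of_tendsto' (aux_tendsto φ F hF)
    fun n => div_nonneg (Real.log_natCast_nonneg _) (Nat.cast_nonneg _)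

lemma aux_section (f : G → Q) (S : Set G) :
    ∃ R ⊆ S, Set.InjOn f R ∧ R.ncard = (f '' S).ncard ∧ f '' R = f '' S := by
  obtain ⟨R, hRS, hR⟩ := (Set.surjOn_image f S).exists_bijOn_subset
  exact ⟨R, hRS, hR.injOn, by rw [← hR.image_eq, Set.ncard_image_of_injOn hR.injOn], hR.image_eq⟩

variable {Z : Type*} [Group Z]

/-- The covering estimate behind the upper bound. -/
lemma aux_cover (φ : G →* G) (S R F E : Set G) (m : ℕ)
    (hS : S = entTraj φ F m) (hE : ∀ n, ∀ x ∈ entTraj φ E n, ∀ y, x * y = y * x)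
    (hRf : R.Finite) (hE1 : E ⊆ entTraj φ E m) (hcov : S ⊆ R * E) (k : ℕ) :
    ∃ P : Set G, P.Finite ∧ P.ncard ≤ R.ncard ^ k ∧
      entTraj φ F (m * k) ⊆ P * entTraj φ E (m * k) := by
  induction k with
  | zero => exact ⟨{1}, Set.finite_singleton _, by simp, by simp [entTraj]⟩
  | succ k ih =>
    obtain ⟨P, hP, hPc, hPs⟩ := ih
    refine ⟨P * (⇑φ)^[m * k] '' R, hP.mul (hRf.image _), ?_, ?_⟩
    · rw [pow_succ]
      exact (aux_ncard_mul _ _).trans (Nat.mul_le_mul hPc (Set.ncard_image_le hRf))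
    · rw [mul_add, mul_one, aux_traj_add, aux_traj_add, ← hS]
      rintro _ ⟨a, ha, _, ⟨b, hb, rfl⟩, rfl⟩
      obtain ⟨p, hp, e, he, rfl⟩ := hPs ha
      obtain ⟨r, hr, e', he', rfl⟩ := hcov hb
      refine ⟨p * (⇑φ)^[m * k] r, ⟨p, hp, _, ⟨r, hr, rfl⟩, rfl⟩, e * (⇑φ)^[m * k] e',
        ⟨e, he, _, ⟨e', hE1 he', rfl⟩, rfl⟩, ?_⟩
      have hc := hE _ e he ((⇑φ)^[m * k] r)
      have hmul : (⇑φ)^[m * k] (r * e') = (⇑φ)^[m * k] r * (⇑φ)^[m * k] e' := by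
        exact iterate_map_mul φ _ _ _
      show p * _ * (e * _) = p * e * (⇑φ)^[m * k] (r * e')
      rw [hmul, mul_assoc, mul_assoc, ← mul_assoc _ e, ← hc, mul_assoc]

lemma aux_upper_m (φ : G →* G) (ψ : Q →* Q) (χ : Z →* Z) (f : G →* Q) (i : Z →* G)
    (hZ : IsLocallyFinite Z)
    (hf : ∀ x, f (φ x) = ψ (f x)) (hi : ∀ x, i (χ x) = φ (i x))
    (hinj : Function.Injective i) (hker : ∀ x, f x = 1 → ∃ z, i z = x)
    (hcen : ∀ z y, i z * y = y * i z) (F : Subgroup G) (hF : (F : Set G).Finite)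
    (m : ℕ) (hm : 0 < m) :
    ∃ E : Subgroup Z, (E : Set Z).Finite ∧
      entH φ F ≤ Real.log (entTraj ψ ((F.map f : Subgroup Q) : Set Q) m).ncard / m
        + entH χ E := by
  obtain ⟨R, hRS, hRinj, hRc, hRim⟩ := aux_section f (entTraj φ (F : Set G) m)
  have hSf := aux_traj_finite φ hF m
  have hRf := hSf.subset hRS
  have hEf : (Subgroup.closure (i ⁻¹' (R⁻¹ * entTraj φ (F : Set G) m)) : Set Z).Finite :=
    hZ _ ((hRf.inv.mul hSf).preimage hinj.injOn)
  set E := Subgroup.closure (i ⁻¹' (R⁻¹ * entTraj φ (F : Set G) m)) with hEdef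
  refine ⟨E, hEf, ?_⟩
  have hTE : ∀ n, i '' entTraj χ (E : Set Z) n = entTraj φ (i '' E) n :=
    fun n => aux_traj_image χ φ i hi _ n
  have hTEc : ∀ n, (entTraj φ (i '' (E : Set Z)) n).ncard = (entTraj χ (E : Set Z) n).ncard :=
    fun n => by rw [← hTE, Set.ncard_image_of_injective _ hinj]
  have hEm : i '' (E : Set Z) ⊆ entTraj φ (i '' E) m := by
    obtain ⟨m', rfl⟩ := Nat.exists_eq_add_of_lt hm
    rw [zero_add, add_comm, aux_traj_add]
    rintro _ ⟨z, hz, rfl⟩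
    have h1E : (1 : G) ∈ i '' (E : Set Z) := ⟨1, E.one_mem, map_one i⟩
    refine ⟨i z, ?_, 1, ⟨1, aux_traj_one_mem _ h1E _, ?_⟩, mul_one _⟩
    · exact ⟨1, Set.mem_singleton _, i z, ⟨i z, ⟨z, hz, rfl⟩, rfl⟩, one_mul _⟩
    · exact iterate_map_one φ _
  have hcov : entTraj φ (F : Set G) m ⊆ R * i '' (E : Set Z) := by
    intro s hs
    have : f s ∈ f '' R := by rw [hRim]; exact ⟨s, hs, rfl⟩
    obtain ⟨r, hr, hrs⟩ := this
    obtain ⟨z, hz⟩ := hker (r⁻¹ * s) (by rw [map_mul, map_inv, hrs, inv_mul_cancel])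
    refine ⟨r, hr, i z, ⟨z, Subgroup.subset_closure ?_, rfl⟩, ?_⟩
    · exact ⟨r⁻¹, Set.inv_mem_inv.2 hr, s, hs, hz.symm⟩
    · show r * i z = s
      rw [hz, mul_inv_cancel_left]
  have hcomm : ∀ n, ∀ x ∈ entTraj φ (i '' (E : Set Z)) n, ∀ y, x * y = y * x := by
    intro n x hx y
    rw [← hTE] at hx
    obtain ⟨z, -, rfl⟩ := hx
    exact hcen z y
  have hRpos : 0 < R.ncard := by
    rw [hRc, Set.ncard_pos (hSf.image _)]
    exact ⟨_, 1, aux_traj_one_mem φ F.one_mem m, rfl⟩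
  have hbar : (entTraj ψ ((F.map f : Subgroup Q) : Set Q) m).ncard = R.ncard := by
    rw [hRc, aux_traj_image φ ψ f hf, Subgroup.coe_map]
  rw [hbar]
  have hmk : Filter.Tendsto (fun k : ℕ => m * k) Filter.atTop Filter.atTop :=
    Filter.tendsto_id.const_mul_atTop' hm
  have t1 := (aux_tendsto φ F hF).comp hmk
  have t2 := ((aux_tendsto χ E hEf).comp hmk).const_add (Real.log R.ncard / m)
  refine le_of_tendsto_of_tendsto t1 t2 ?_
  filter_upwards [Filter.eventually_gt_atTop 0] with k hk
  obtain ⟨P, hP, hPc, hPs⟩ := aux_cover φ _ R F (i '' (E : Set Z)) m rfl hcomm hRf hEm hcov k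
  have hle : (entTraj φ (F : Set G) (m * k)).ncard
      ≤ R.ncard ^ k * (entTraj χ (E : Set Z) (m * k)).ncard := by
    rw [← hTEc]
    exact (Set.ncard_le_ncard hPs (hP.mul (aux_traj_finite φ (hEf.image _) _))).trans
      ((aux_ncard_mul _ _).trans (Nat.mul_le_mul_right _ hPc))
  have p1 := aux_ncard_pos φ hF F.one_mem (m * k)
  have p2 := aux_ncard_pos χ hEf E.one_mem (m * k)
  have hlog : Real.log (entTraj φ (F : Set G) (m * k)).ncard
      ≤ k * Real.log R.ncard + Real.log (entTraj χ (E : Set Z) (m * k)).ncard := by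
    rw [← Real.log_pow, ← Real.log_mul (by positivity) (by positivity)]
    apply Real.log_le_log (by positivity)
    exact_mod_cast hle
  have hm' : (0 : ℝ) < m := by exact_mod_cast hm
  have hk' : (0 : ℝ) < k := by exact_mod_cast hk
  show Real.log _ / ((m * k : ℕ) : ℝ) ≤ Real.log R.ncard / m + Real.log _ / ((m * k : ℕ) : ℝ)
  have e : Real.log R.ncard / m = k * Real.log R.ncard / ((m * k : ℕ) : ℝ) := by
    push_cast; field_simp
  rw [e, ← add_div]
  gcongr

lemma aux_upper (φ : G →* G) (ψ : Q →* Q) (χ : Z →* Z) (f : G →* Q) (i : Z →* G)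
    (hZ : IsLocallyFinite Z)
    (hf : ∀ x, f (φ x) = ψ (f x)) (hi : ∀ x, i (χ x) = φ (i x))
    (hinj : Function.Injective i) (hker : ∀ x, f x = 1 → ∃ z, i z = x)
    (hcen : ∀ z y, i z * y = y * i z) : algEnt φ ≤ algEnt χ + algEnt ψ := by
  refine iSup₂_le fun F hF => ?_
  have hFf : ((F.map f : Subgroup Q) : Set Q).Finite := by
    rw [Subgroup.coe_map]; exact hF.image _
  have hψ : ENNReal.ofReal (entH ψ (F.map f)) ≤ algEnt ψ :=
    le_iSup₂ (f := fun (F : Subgroup Q) (_ : (F : Set Q).Finite) => ENNReal.ofReal (entH ψ F))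
      _ hFf
  refine le_trans ?_ (add_le_add le_rfl hψ)
  have t := (ENNReal.tendsto_ofReal (aux_tendsto ψ (F.map f) hFf)).const_add (algEnt χ)
  refine ge_of_tendsto t ?_
  filter_upwards [Filter.eventually_gt_atTop 0] with m hm
  obtain ⟨E, hE, hle⟩ := aux_upper_m φ ψ χ f i hZ hf hi hinj hker hcen F hF m hm
  have hχ : ENNReal.ofReal (entH χ E) ≤ algEnt χ :=
    le_iSup₂ (f := fun (F : Subgroup Z) (_ : (F : Set Z).Finite) => ENNReal.ofReal (entH χ F))
      _ hE
  refine (ENNReal.ofReal_le_ofReal hle).trans (ENNReal.ofReal_add_le.trans ?_)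
  rw [add_comm]
  exact add_le_add hχ le_rfl

lemma aux_absorb (φ : G →* G) (E F : Set G)
    (hcen : ∀ n, ∀ x ∈ entTraj φ E n, ∀ y, x * y = y * x)
    (hEF : E * F ⊆ F) (hEc : ∀ n, ∀ x ∈ (⇑φ)^[n] '' E, ∀ y, x * y = y * x) (n : ℕ) :
    entTraj φ E n * entTraj φ F n ⊆ entTraj φ F n := by
  induction n with
  | zero => simp [entTraj]
  | succ n ih =>
    rintro _ ⟨_, ⟨a, ha, _, ⟨e, he, rfl⟩, rfl⟩, _, ⟨b, hb, _, ⟨x, hx, rfl⟩, rfl⟩, rfl⟩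
    refine ⟨a * b, ih ⟨a, ha, b, hb, rfl⟩, (⇑φ)^[n] (e * x),
      ⟨_, hEF ⟨e, he, x, hx, rfl⟩, rfl⟩, ?_⟩
    have hc := hEc n _ ⟨e, he, rfl⟩ b
    have hmul : (⇑φ)^[n] (e * x) = (⇑φ)^[n] e * (⇑φ)^[n] x := by
      exact iterate_map_mul φ _ _ _
    show a * b * (⇑φ)^[n] (e * x) = a * (⇑φ)^[n] e * (b * (⇑φ)^[n] x)
    rw [hmul, mul_assoc a, mul_assoc a, ← mul_assoc ((⇑φ)^[n] e) b, hc, mul_assoc b]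

lemma aux_lower (φ : G →* G) (ψ : Q →* Q) (χ : Z →* Z) (f : G →* Q) (i : Z →* G)
    (hG : IsLocallyFinite G) (hsurj : Function.Surjective f)
    (hf : ∀ x, f (φ x) = ψ (f x)) (hi : ∀ x, i (χ x) = φ (i x))
    (hinj : Function.Injective i) (hker : ∀ z, f (i z) = 1)
    (hcen : ∀ z y, i z * y = y * i z) : algEnt χ + algEnt ψ ≤ algEnt φ := by
  refine ENNReal.biSup_add_biSup_le' ⟨⊥, by simp⟩ ⟨⊥, by simp⟩ fun E hE D hD => ?_
  obtain ⟨g, hg⟩ := hsurj.hasRightInverse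
  have hFf := hG (i '' (E : Set Z) ∪ g '' (D : Set Q)) ((hE.image _).union (hD.image _))
  set F := Subgroup.closure (i '' (E : Set Z) ∪ g '' (D : Set Q))
  refine le_trans ?_ (le_iSup₂ (f := fun (F : Subgroup G) (_ : (F : Set G).Finite) =>
    ENNReal.ofReal (entH φ F)) F hFf)
  rw [← ENNReal.ofReal_add (aux_nonneg χ E hE) (aux_nonneg ψ D hD)]
  apply ENNReal.ofReal_le_ofReal
  refine le_of_tendsto_of_tendsto' ((aux_tendsto χ E hE).add (aux_tendsto ψ D hD))
    (aux_tendsto φ F hFf) fun n => ?_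
  rw [← add_div]
  have p1 := aux_ncard_pos χ hE E.one_mem n
  have p2 := aux_ncard_pos ψ hD D.one_mem n
  rw [← Real.log_mul (by positivity) (by positivity)]
  gcongr
  have hTE : ∀ n, i '' entTraj χ (E : Set Z) n = entTraj φ (i '' E) n :=
    fun n => aux_traj_image χ φ i hi _ n
  have habs := aux_absorb φ (i '' (E : Set Z)) F
    (by
      intro n x hx y
      rw [← hTE] at hx
      obtain ⟨z, -, rfl⟩ := hx
      exact hcen z y)
    (by
      rintro _ ⟨x, hx, y, hy, rfl⟩
      exact F.mul_mem (Subgroup.subset_closure (Or.inl hx)) hy)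
    (by
      rintro n _ ⟨_, ⟨z, -, rfl⟩, rfl⟩ y
      have hs : Function.Semiconj i χ φ := hi
      rw [← (hs.iterate_right n).eq]
      exact hcen _ _) n
  have hTf := aux_traj_finite φ hFf n
  have hDF : entTraj ψ (D : Set Q) n ⊆ f '' entTraj φ (F : Set G) n := by
    rw [aux_traj_image φ ψ f hf]
    apply aux_traj_mono
    intro d hd
    exact ⟨g d, Subgroup.subset_closure (Or.inr ⟨d, hd, rfl⟩), hg d⟩
  obtain ⟨R, hRS, hRinj, hRc, hRim⟩ := aux_section f (entTraj φ (F : Set G) n)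
  have h1 : (entTraj ψ (D : Set Q) n).ncard ≤ R.ncard := by
    rw [hRc]; exact Set.ncard_le_ncard hDF (hTf.image _)
  have h2 : ((entTraj χ (E : Set Z) n) ×ˢ R).ncard ≤ (entTraj φ (F : Set G) n).ncard := by
    refine Set.ncard_le_ncard_of_injOn (fun p => i p.1 * p.2) ?_ ?_ hTf
    · rintro ⟨e, r⟩ ⟨he, hr⟩
      exact habs ⟨i e, hTE n ▸ ⟨e, he, rfl⟩, r, hRS hr, rfl⟩
    · rintro ⟨e, r⟩ ⟨he, hr⟩ ⟨e', r'⟩ ⟨he', hr'⟩ h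
      have h : i e * r = i e' * r' := h
      have h3 : r = r' := by
        apply hRinj hr hr'
        simpa [hker] using congrArg f h
      subst h3
      rw [hinj (mul_right_cancel h)]
  rw [Set.ncard_prod] at h2
  exact_mod_cast (Nat.mul_le_mul_left _ h1).trans h2

lemma aux_locFin_sub (hG : IsLocallyFinite G) (H : Subgroup G) : IsLocallyFinite H := by
  intro S hS
  have h := hG (H.subtype '' S) (hS.image _)
  rw [← MonoidHom.map_closure, Subgroup.coe_map] at h
  exact h.of_finite_image H.subtype_injective.injOn

end aux

end AlgEntropy

theorem algEnt_eq_center_aut {G : Type*} [Group G] (hG : IsLocallyFinite G) (φ : G ≃* G) :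
    AlgEntropy.algEnt φ.toMonoidHom =
      AlgEntropy.algEnt (AlgEntropy.endRestrict φ.toMonoidHom (Subgroup.center G)
        (AlgEntropy.center_le_comap_equiv φ)) +
      AlgEntropy.entQuot φ.toMonoidHom (Subgroup.center G) inferInstance
        (AlgEntropy.center_le_comap_equiv φ) := by
  apply le_antisymm
  · exact AlgEntropy.aux_upper _ _ _ (QuotientGroup.mk' (Subgroup.center G))
      (Subgroup.center G).subtype (AlgEntropy.aux_locFin_sub hG _) (fun _ => rfl) (fun _ => rfl)
      (Subgroup.subtype_injective _)
      (fun x hx => ⟨⟨x, (QuotientGroup.eq_one_iff x).1 hx⟩, rfl⟩)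
      (fun z y => (Subgroup.mem_center_iff.1 z.2 y).symm)
  · exact AlgEntropy.aux_lower _ _ _ (QuotientGroup.mk' (Subgroup.center G))
      (Subgroup.center G).subtype hG (QuotientGroup.mk'_surjective _) (fun _ => rfl)
      (fun _ => rfl) (Subgroup.subtype_injective _)
      (fun z => (QuotientGroup.eq_one_iff z.1).2 z.2)
      (fun z y => (Subgroup.mem_center_iff.1 z.2 y).symm)
end

section
/- Let G be a torsion nilpotent group, let φ be an endomorphism of G, and let H be a φ-invariant normal subgroup of G. Then h(φ) = h(φ↾_H) + h(φ̄), where φ̄ is the endomorphism induced by φ on G/H; that is, the Addition Theorem AT(G,φ,H) holds. -/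
open scoped Pointwise ENNReal

namespace AlgEntropy

lemma finite_of_fg_nilp (G : Type*) [Group G] [Group.IsNilpotent G] :
    (∀ g : G, IsOfFinOrder g) → Group.FG G → Finite G := by
  refine Group.nilpotent_center_quotient_ind
    (P := fun G _ _ => (∀ g : G, IsOfFinOrder g) → Group.FG G → Finite G) G ?_ ?_
  · intro G _ _ _ _
    infer_instance
  · intro G _ _ ih ht hfg
    have h1 : Finite (G ⧸ Subgroup.center G) := by
      refine ih ?_ inferInstance
      intro g
      obtain ⟨x, rfl⟩ := QuotientGroup.mk_surjective g
      exact (QuotientGroup.mk' (Subgroup.center G)).isOfFinOrder (ht x)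
    have h2 : (Subgroup.center G).FiniteIndex := Subgroup.finiteIndex_of_finite_quotient
    have h3 : Group.FG (Subgroup.center G) := Subgroup.fg_of_index_ne_zero _
    have h4 : Finite (Subgroup.center G) := by
      letI : CommGroup (Subgroup.center G) :=
        { (inferInstance : Group (Subgroup.center G)) with
          mul_comm := fun a b => Subtype.ext (Subgroup.mem_center_iff.1 b.2 a) }
      refine CommGroup.finite_of_fg_isMulTorsion _ ?_
      intro g
      exact Submonoid.isOfFinOrder_coe.1 (ht g)
    exact Finite.of_subgroup_quotient (Subgroup.center G)

lemma locFin_nilp (G : Type*) [Group G] [Group.IsNilpotent G] (ht : ∀ g : G, IsOfFinOrder g) :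
    IsLocallyFinite G := by
  intro S hS
  have : Finite (Subgroup.closure S) := by
    refine finite_of_fg_nilp _ (fun g => Submonoid.isOfFinOrder_coe.1 (ht g)) ?_
    have := hS.to_subtype
    exact Group.closure_finite_fg S
  exact Set.toFinite _

section traj
variable {G : Type*} [Group G] (φ : G →* G)

lemma traj_finite {F : Set G} (hF : F.Finite) (n : ℕ) : (entTraj φ F n).Finite := by
  induction n with
  | zero => exact Set.finite_singleton _
  | succ n ih => exact ih.mul (hF.image _)

lemma one_mem_traj {F : Set G} (hF : 1 ∈ F) (n : ℕ) : 1 ∈ entTraj φ F n := by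
  induction n with
  | zero => rfl
  | succ n ih => exact ⟨1, ih, 1, ⟨1, hF, iterate_map_one φ n⟩, one_mul 1⟩

lemma traj_mono {F F' : Set G} (h : F ⊆ F') (n : ℕ) : entTraj φ F n ⊆ entTraj φ F' n := by
  induction n with
  | zero => exact subset_rfl
  | succ n ih => exact Set.mul_subset_mul ih (Set.image_mono h)

lemma traj_add (F : Set G) (n m : ℕ) :
    entTraj φ F (n + m) = entTraj φ F n * (⇑φ)^[n] '' (entTraj φ F m) := by
  induction m with
  | zero => simp [entTraj]
  | succ m ih =>
    have : ∀ s t : Set G, (⇑φ)^[n] '' (s * t) = (⇑φ)^[n] '' s * (⇑φ)^[n] '' t := by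
      intro s t
      exact Set.image_image2_distrib (fun a b => iterate_map_mul φ n a b)
    rw [← Nat.add_assoc]
    simp only [entTraj]
    rw [ih, this, mul_assoc, ← Set.image_comp, ← Function.iterate_add]

lemma subset_traj {F : Set G} (hF : 1 ∈ F) {n : ℕ} (hn : n ≠ 0) : F ⊆ entTraj φ F n := by
  obtain ⟨m, rfl⟩ : ∃ m, n = 1 + m := ⟨n - 1, by omega⟩
  rw [traj_add]
  intro x hx
  refine ⟨x, ⟨1, rfl, x, ⟨x, hx, rfl⟩, one_mul _⟩, 1, ⟨1, one_mem_traj φ hF m, ?_⟩, mul_one _⟩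
  exact iterate_map_one φ 1

lemma ncard_mul_le' {s t : Set G} : (s * t).ncard ≤ s.ncard * t.ncard := Set.natCard_mul_le

lemma traj_pos (F : Subgroup G) (hF : (F : Set G).Finite) (n : ℕ) :
    0 < (entTraj φ (F : Set G) n).ncard :=
  (Set.ncard_pos (traj_finite φ hF n)).2 ⟨1, one_mem_traj φ F.one_mem n⟩

noncomputable def u (F : Subgroup G) (n : ℕ) : ℝ := Real.log (entTraj φ (F : Set G) n).ncard

lemma u_nonneg (F : Subgroup G) (n : ℕ) : 0 ≤ u φ F n := Real.log_natCast_nonneg _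

lemma u_sub (F : Subgroup G) (hF : (F : Set G).Finite) : Subadditive (u φ F) := by
  intro m n
  unfold u
  have h1 := traj_pos φ F hF m
  have h2 := traj_pos φ F hF n
  have h3 := traj_pos φ F hF (m + n)
  rw [← Real.log_mul (by positivity) (by positivity)]
  apply Real.log_le_log (by positivity)
  rw [traj_add]
  refine le_trans (Nat.cast_le.2 (ncard_mul_le')) ?_
  push_cast
  have := Set.ncard_image_le (f := (⇑φ)^[m]) (traj_finite φ hF n)
  gcongr

lemma u_bdd (F : Subgroup G) : BddBelow (Set.range fun n => u φ F n / n) := by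
  refine ⟨0, ?_⟩
  rintro _ ⟨n, rfl⟩
  exact div_nonneg (u_nonneg φ F n) (Nat.cast_nonneg n)

lemma entH_tendsto (F : Subgroup G) (hF : (F : Set G).Finite) :
    Filter.Tendsto (fun n : ℕ => u φ F n / n) Filter.atTop (nhds (entH φ F)) := by
  have h := (u_sub φ F hF).tendsto_lim (u_bdd φ F)
  have : entH φ F = (u_sub φ F hF).lim := h.limsup_eq
  rw [this]
  exact h

lemma entH_nonneg (F : Subgroup G) (hF : (F : Set G).Finite) : 0 ≤ entH φ F :=
  ge_of_tendsto' (entH_tendsto φ F hF) fun n => div_nonneg (u_nonneg φ F n) (Nat.cast_nonneg n)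

lemma le_algEnt (F : Subgroup G) (hF : (F : Set G).Finite) :
    ENNReal.ofReal (entH φ F) ≤ algEnt φ :=
  le_iSup₂ (f := fun (F : Subgroup G) (_ : (F : Set G).Finite) => ENNReal.ofReal (entH φ F)) F hF

end traj

section ext
variable {K G Q : Type*} [Group K] [Group G] [Group Q]
  (ι : K →* G) (π : G →* Q) (κ : K →* K) (φ : G →* G) (ψ : Q →* Q)

lemma traj_image (hπ : ∀ x, π (φ x) = ψ (π x)) (F : Set G) (n : ℕ) :
    π '' entTraj φ F n = entTraj ψ (π '' F) n := by
  have hit : ∀ n x, π ((⇑φ)^[n] x) = (⇑ψ)^[n] (π x) := fun n x =>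
    Function.Semiconj.iterate_right (f := π) (ga := φ) (gb := ψ) hπ n x
  induction n with
  | zero => simp [entTraj]
  | succ n ih =>
    simp only [entTraj]
    rw [Set.image_mul, ih, ← Set.image_comp, ← Set.image_comp]
    congr 1
    apply Set.image_congr
    intro a _
    exact hit n a

lemma lower_aux (hι : ∀ x, ι (κ x) = φ (ι x)) (hπ : ∀ x, π (φ x) = ψ (π x))
    (hc : ∀ k x, ι k * x = x * ι k) (F : Subgroup G) (F' : Set K) (F'' : Set Q)
    (h1 : ∀ k ∈ F', ι k ∈ F) (h2 : ∀ q ∈ F'', ∃ x ∈ F, π x = q) (n : ℕ) :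
    ∀ t ∈ entTraj ψ F'' n, ∃ x, π x = t ∧ ∀ k ∈ entTraj κ F' n, x * ι k ∈ entTraj φ F n := by
  have hit : ∀ n x, π ((⇑φ)^[n] x) = (⇑ψ)^[n] (π x) := fun n x =>
    Function.Semiconj.iterate_right (f := π) (ga := φ) (gb := ψ) hπ n x
  have hit' : ∀ n x, ι ((⇑κ)^[n] x) = (⇑φ)^[n] (ι x) := fun n x =>
    Function.Semiconj.iterate_right (f := ι) (ga := κ) (gb := φ) hι n x
  induction n with
  | zero =>
    rintro t rfl
    refine ⟨1, map_one _, ?_⟩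
    rintro k rfl
    simp [entTraj]
  | succ n ih =>
    rintro _ ⟨t, ht, _, ⟨q, hq, rfl⟩, rfl⟩
    obtain ⟨x, rfl, hx⟩ := ih t ht
    obtain ⟨f, hf, rfl⟩ := h2 q hq
    refine ⟨x * (⇑φ)^[n] f, by simp [hit], ?_⟩
    rintro _ ⟨k, hk, _, ⟨l, hl, rfl⟩, rfl⟩
    refine ⟨x * ι k, hx k hk, _, ⟨f * ι l, F.mul_mem hf (h1 l hl), rfl⟩, ?_⟩
    simp only [map_mul, hit', iterate_map_mul]
    rw [mul_assoc, mul_assoc, ← mul_assoc (ι k), hc k, mul_assoc]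

lemma upper_aux (hιi : Function.Injective ι)
    (hex : ∀ x, π x = 1 → ∃ k, ι k = x)
    (hι : ∀ x, ι (κ x) = φ (ι x)) (hπ : ∀ x, π (φ x) = ψ (π x))
    (hc : ∀ k x, ι k * x = x * ι k) (hK : IsLocallyFinite K)
    (F : Subgroup G) (hF : (F : Set G).Finite) (m : ℕ) (hm : m ≠ 0) :
    ∃ F' : Subgroup K, (F' : Set K).Finite ∧ ∀ k : ℕ, ∃ S : Set G, S.Finite ∧
      S.ncard ≤ (entTraj ψ (F.map π : Set Q) m).ncard ^ k ∧
      entTraj φ (F : Set G) (m * k) ⊆ S * ι '' entTraj κ (F' : Set K) (m * k) := by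
  have hit' : ∀ n x, ι ((⇑κ)^[n] x) = (⇑φ)^[n] (ι x) := fun n x =>
    Function.Semiconj.iterate_right (f := ι) (ga := κ) (gb := φ) hι n x
  have hTf := traj_finite φ hF m
  have himg : π '' entTraj φ (F : Set G) m = entTraj ψ (F.map π : Set Q) m := by
    rw [traj_image π φ ψ hπ]; rfl
  let E : Set K := ι ⁻¹' ((entTraj φ (F : Set G) m)⁻¹ * entTraj φ (F : Set G) m)
  have hE : E.Finite := (hTf.inv.mul hTf).preimage hιi.injOn
  have hs : ∀ t, ∃ x, t ∈ entTraj ψ (F.map π : Set Q) m → x ∈ entTraj φ (F : Set G) m ∧ π x = t := by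
    intro t
    by_cases ht : t ∈ entTraj ψ (F.map π : Set Q) m
    · rw [← himg] at ht
      obtain ⟨x, hx, rfl⟩ := ht
      exact ⟨x, fun _ => ⟨hx, rfl⟩⟩
    · exact ⟨1, fun h => absurd h ht⟩
  choose s hs using hs
  have hQf : (entTraj ψ (F.map π : Set Q) m).Finite := by
    rw [← himg]; exact hTf.image _
  refine ⟨Subgroup.closure E, hK E hE, ?_⟩
  intro k
  induction k with
  | zero =>
    refine ⟨{1}, Set.finite_singleton _, by simp, ?_⟩
    simp [entTraj]
  | succ k ih =>
    obtain ⟨S, hSf, hSc, hS⟩ := ih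
    refine ⟨S * (⇑φ)^[m * k] '' (s '' entTraj ψ (F.map π : Set Q) m),
      hSf.mul ((hQf.image _).image _), ?_, ?_⟩
    · refine ncard_mul_le'.trans ?_
      rw [pow_succ]
      refine Nat.mul_le_mul hSc ?_
      exact (Set.ncard_image_le (hQf.image _)).trans (Set.ncard_image_le hQf)
    · rw [Nat.mul_succ, traj_add, traj_add]
      rintro _ ⟨x, hx, _, ⟨y, hy, rfl⟩, rfl⟩
      obtain ⟨a, ha, _, ⟨b, hb, rfl⟩, rfl⟩ := hS hx
      have hy' : π y ∈ entTraj ψ (F.map π : Set Q) m := himg ▸ ⟨y, hy, rfl⟩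
      obtain ⟨h1, h2⟩ := hs _ hy'
      obtain ⟨e, he⟩ := hex ((s (π y))⁻¹ * y) (by simp [h2])
      have heE : e ∈ E := by
        change ι e ∈ (entTraj φ (F : Set G) m)⁻¹ * entTraj φ (F : Set G) m
        rw [he]
        exact Set.mul_mem_mul (Set.inv_mem_inv.2 h1) hy
      refine ⟨a * (⇑φ)^[m * k] (s (π y)), ⟨a, ha, _, ⟨_, ⟨_, hy', rfl⟩, rfl⟩, rfl⟩,
        ι (b * (⇑κ)^[m * k] e), ⟨_, ⟨b, hb, _, ⟨e, ?_, rfl⟩, rfl⟩, rfl⟩, ?_⟩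
      · exact subset_traj κ (Subgroup.one_mem _) hm (Subgroup.subset_closure heE)
      · have hyy : y = s (π y) * ι e := by rw [he]; group
        simp only
        conv_rhs => rw [hyy]
        rw [map_mul, hit', iterate_map_mul, mul_assoc, mul_assoc, hc b, hc b, mul_assoc]

lemma central_add (hιi : Function.Injective ι) (hπs : Function.Surjective π)
    (hex : ∀ x, π x = 1 ↔ ∃ k, ι k = x)
    (hι : ∀ x, ι (κ x) = φ (ι x)) (hπ : ∀ x, π (φ x) = ψ (π x))
    (hc : ∀ k x, ι k * x = x * ι k) (hK : IsLocallyFinite K) (hG : IsLocallyFinite G) :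
    algEnt φ = algEnt κ + algEnt ψ := by
  apply le_antisymm
  · refine iSup₂_le fun F hF => ?_
    have hQ : ((F.map π : Subgroup Q) : Set Q).Finite := hF.image π
    have key : ∀ m : ℕ, m ≠ 0 →
        ENNReal.ofReal (entH φ F) ≤ algEnt κ + ENNReal.ofReal (u ψ (F.map π) m / m) := by
      intro m hm
      obtain ⟨F', hF', h⟩ := upper_aux ι π κ φ ψ hιi (fun x => (hex x).1) hι hπ hc hK F hF m hm
      have hreal : entH φ F ≤ entH κ F' + u ψ (F.map π) m / m := by
        have hmk : Filter.Tendsto (fun k : ℕ => m * k) Filter.atTop Filter.atTop :=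
          Filter.tendsto_id.const_mul_atTop' (Nat.pos_of_ne_zero hm)
        have t1 := (entH_tendsto φ F hF).comp hmk
        have t2 := ((entH_tendsto κ F' hF').comp hmk).add_const (u ψ (F.map π) m / m)
        refine le_of_tendsto_of_tendsto t1 t2 ?_
        filter_upwards [Filter.eventually_gt_atTop 0] with k hk
        obtain ⟨S, hSf, hSc, hS⟩ := h k
        have p1 := traj_pos φ F hF (m * k)
        have p2 := traj_pos κ F' hF' (m * k)
        have p3 := traj_pos ψ (F.map π) hQ m
        have hcard : (entTraj φ (F : Set G) (m * k)).ncard ≤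
            (entTraj ψ (F.map π : Set Q) m).ncard ^ k * (entTraj κ (F' : Set K) (m * k)).ncard := by
          have hfin := traj_finite κ hF' (m * k)
          refine (Set.ncard_le_ncard hS (hSf.mul (hfin.image _))).trans ?_
          refine ncard_mul_le'.trans (Nat.mul_le_mul hSc (Set.ncard_image_le hfin))
        have hu : u φ F (m * k) ≤ k * u ψ (F.map π) m + u κ F' (m * k) := by
          unfold u
          rw [← Real.log_pow, ← Real.log_mul (by positivity) (by positivity)]
          apply Real.log_le_log (by positivity)
          exact_mod_cast hcard
        have hm' : (0 : ℝ) < m := by exact_mod_cast Nat.pos_of_ne_zero hm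
        have hk' : (0 : ℝ) < k := by exact_mod_cast hk
        simp only [Function.comp]
        push_cast
        calc u φ F (m * k) / (m * k) ≤ (k * u ψ (F.map π) m + u κ F' (m * k)) / (m * k) := by
              gcongr
          _ = _ := by field_simp; ring
      refine (ENNReal.ofReal_le_ofReal hreal).trans (ENNReal.ofReal_add_le.trans ?_)
      gcongr
      exact le_algEnt κ F' hF'
    have t : Filter.Tendsto (fun m : ℕ => algEnt κ + ENNReal.ofReal (u ψ (F.map π) m / m))
        Filter.atTop (nhds (algEnt κ + ENNReal.ofReal (entH ψ (F.map π)))) :=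
      tendsto_const_nhds.add (ENNReal.tendsto_ofReal (entH_tendsto ψ _ hQ))
    refine (ge_of_tendsto t ?_).trans ?_
    · filter_upwards [Filter.eventually_gt_atTop 0] with m hm
      exact key m hm.ne'
    · gcongr
      exact le_algEnt ψ _ hQ
  · have main : ∀ F' : Subgroup K, (F' : Set K).Finite → ∀ F'' : Subgroup Q, (F'' : Set Q).Finite →
        ENNReal.ofReal (entH κ F') + ENNReal.ofReal (entH ψ F'') ≤ algEnt φ := by
      intro F' hF' F'' hF''
      obtain ⟨s, hs⟩ := hπs.hasRightInverse
      let E : Set G := ι '' F' ∪ s '' F''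
      have hE : E.Finite := (hF'.image _).union (hF''.image _)
      let F := Subgroup.closure E
      have hF : (F : Set G).Finite := hG E hE
      have hl := lower_aux ι π κ φ ψ hι hπ hc F F' F''
        (fun k hk => Subgroup.subset_closure (Or.inl ⟨k, hk, rfl⟩))
        (fun q hq => ⟨s q, Subgroup.subset_closure (Or.inr ⟨q, hq, rfl⟩), hs q⟩)
      rw [← ENNReal.ofReal_add (entH_nonneg κ F' hF') (entH_nonneg ψ F'' hF'')]
      refine le_trans (ENNReal.ofReal_le_ofReal ?_) (le_algEnt φ F hF)
      refine le_of_tendsto_of_tendsto' ((entH_tendsto κ F' hF').add (entH_tendsto ψ F'' hF''))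
        (entH_tendsto φ F hF) ?_
      intro n
      rw [← add_div]
      gcongr
      have p1 := traj_pos φ F hF n
      have p2 := traj_pos κ F' hF' n
      have p3 := traj_pos ψ F'' hF'' n
      unfold u
      rw [← Real.log_mul (by positivity) (by positivity)]
      apply Real.log_le_log (by positivity)
      norm_cast
      choose! x hx1 hx2 using hl n
      rw [← Set.ncard_prod]
      refine Set.ncard_le_ncard_of_injOn (fun p => x p.2 * ι p.1) ?_ ?_ (traj_finite φ hF n)
      · rintro ⟨a, b⟩ ⟨ha, hb⟩
        exact hx2 b hb a ha
      · rintro ⟨a, b⟩ ⟨ha, hb⟩ ⟨a', b'⟩ ⟨ha', hb'⟩ heq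
        simp only at heq ha hb ha' hb'
        have hk : ∀ k, π (ι k) = 1 := fun k => (hex _).2 ⟨k, rfl⟩
        have hbb : b = b' := by
          have := congrArg π heq
          rwa [map_mul, map_mul, hk, hk, mul_one, mul_one, hx1 b hb, hx1 b' hb'] at this
        subst hbb
        rw [hιi (mul_left_cancel heq)]
    exact ENNReal.biSup_add_biSup_le' ⟨⊥, by simp⟩ ⟨⊥, by simp⟩ main

end ext

def cser {G : Type*} [Group G] (H : Subgroup G) : ℕ → Subgroup G
  | 0 => H
  | k + 1 => ⁅cser H k, ⊤⁆

lemma cser_le_lower {G : Type*} [Group G] (H : Subgroup G) (k : ℕ) :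
    cser H k ≤ (⊤ : Subgroup G).lowerCentralSeries k := by
  induction k with
  | zero => exact le_top
  | succ k ih => exact Subgroup.commutator_mono ih le_rfl

lemma cser_normal {G : Type*} [Group G] (H : Subgroup G) (hN : H.Normal) (k : ℕ) :
    (cser H k).Normal := by
  induction k with
  | zero => exact hN
  | succ k ih => exact Subgroup.commutator_normal _ _

lemma cser_le {G : Type*} [Group G] (H : Subgroup G) (hN : H.Normal) (k : ℕ) :
    cser H k ≤ H := by
  induction k with
  | zero => exact le_rfl
  | succ k ih =>
    have := cser_normal H hN k
    exact (Subgroup.commutator_le_left _ _).trans ih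

lemma cser_inv {G : Type*} [Group G] (φ : G →* G) (H : Subgroup G) (hH : H ≤ H.comap φ) (k : ℕ) :
    cser H k ≤ (cser H k).comap φ := by
  rw [← Subgroup.map_le_iff_le_comap] at *
  induction k with
  | zero => exact hH
  | succ k ih =>
    show Subgroup.map φ ⁅cser H k, ⊤⁆ ≤ _
    rw [Subgroup.map_commutator]
    exact Subgroup.commutator_mono ih le_top

lemma cser_map {G G' : Type*} [Group G] [Group G'] (f : G →* G') (hf : Function.Surjective f)
    (H : Subgroup G) (k : ℕ) : (cser H k).map f = cser (H.map f) k := by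
  induction k with
  | zero => rfl
  | succ k ih =>
    show Subgroup.map f ⁅cser H k, ⊤⁆ = ⁅cser (H.map f) k, ⊤⁆
    rw [Subgroup.map_commutator, ih, Subgroup.map_top_of_surjective f hf]

universe v w

lemma main_ind (k : ℕ) : ∀ (G : Type v) (Q : Type w) [Group G] [Group Q] [Group.IsNilpotent G]
    (_ : ∀ g : G, IsOfFinOrder g) (φ : G →* G) (ψ : Q →* Q) (π : G →* Q)
    (_ : Function.Surjective π) (_ : ∀ x, π (φ x) = ψ (π x)) (H : Subgroup G) (_ : π.ker = H)
    (hH : H ≤ H.comap φ) (_ : cser H k = ⊥),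
    algEnt φ = algEnt (endRestrict φ H hH) + algEnt ψ := by
  induction k with
  | zero =>
    intro G Q _ _ _ ht φ ψ π hs he H hk hH hb
    have hb : H = ⊥ := hb
    refine central_add H.subtype π _ φ ψ H.subtype_injective hs ?_ (fun _ => rfl) he ?_
      (locFin_nilp _ fun g => Submonoid.isOfFinOrder_coe.1 (ht g)) (locFin_nilp _ ht)
    · intro x
      rw [← MonoidHom.mem_ker, hk]
      exact ⟨fun h => ⟨⟨x, h⟩, rfl⟩, by rintro ⟨y, rfl⟩; exact y.2⟩
    · rintro ⟨y, hy⟩ x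
      have : y = 1 := by simpa [hb] using hy
      simp [this]
  | succ k ih =>
    intro G Q _ _ _ ht φ ψ π hs he H hk hH hb
    have hHn : H.Normal := hk ▸ inferInstance
    have hNn := cser_normal H hHn k
    have hNi := cser_inv φ H hH k
    have hNH := cser_le H hHn k
    have hNc : cser H k ≤ Subgroup.center G := by
      have hb : ⁅cser H k, ⊤⁆ = ⊥ := hb
      rw [Subgroup.commutator_eq_bot_iff_le_centralizer] at hb
      simpa [Subgroup.centralizer_univ] using hb
    have hNm := cser_map (QuotientGroup.mk' (cser H k)) (QuotientGroup.mk'_surjective _) H k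
    rw [QuotientGroup.map_mk'_self] at hNm
    generalize cser H k = N at *
    have hlf := locFin_nilp G ht
    have hlfS : ∀ L : Subgroup G, IsLocallyFinite L := fun L =>
      locFin_nilp _ fun g => Submonoid.isOfFinOrder_coe.1 (ht g)
    let φ' := QuotientGroup.map N N φ hNi
    let π' : G ⧸ N →* Q := QuotientGroup.lift N π (fun x hx => by
      have := hNH hx
      rwa [← hk] at this)
    let H' := H.map (QuotientGroup.mk' N)
    have hH' : H' ≤ H'.comap φ' := by
      rintro _ ⟨x, hx, rfl⟩
      exact ⟨φ x, hH hx, rfl⟩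
    have e1 : algEnt φ = algEnt (endRestrict φ N hNi) + algEnt φ' := by
      refine central_add N.subtype (QuotientGroup.mk' N) _ φ φ' N.subtype_injective
        (QuotientGroup.mk'_surjective _) ?_ (fun _ => rfl) (fun _ => rfl) ?_ (hlfS N) hlf
      · intro x
        rw [← MonoidHom.mem_ker, QuotientGroup.ker_mk']
        exact ⟨fun h => ⟨⟨x, h⟩, rfl⟩, by rintro ⟨y, rfl⟩; exact y.2⟩
      · rintro ⟨y, hy⟩ x
        exact (Subgroup.mem_center_iff.1 (hNc hy) x).symm
    have e2 : algEnt φ' = algEnt (endRestrict φ' H' hH') + algEnt ψ := by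
      refine ih (G ⧸ N) Q ?_ φ' ψ π' ?_ ?_ H' ?_ hH' hNm.symm
      · intro g
        obtain ⟨x, rfl⟩ := QuotientGroup.mk_surjective g
        exact (QuotientGroup.mk' N).isOfFinOrder (ht x)
      · intro q
        obtain ⟨x, rfl⟩ := hs q
        exact ⟨QuotientGroup.mk' N x, rfl⟩
      · intro x
        obtain ⟨x, rfl⟩ := QuotientGroup.mk_surjective x
        exact he x
      · ext x
        obtain ⟨x, rfl⟩ := QuotientGroup.mk_surjective x
        constructor
        · intro hx
          refine ⟨x, ?_, rfl⟩
          have : x ∈ π.ker := hx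
          rwa [hk] at this
        · rintro ⟨y, hy, hyx⟩
          rw [← hyx]
          have : y ∈ π.ker := by rw [hk]; exact hy
          exact this
    have e3 : algEnt (endRestrict φ H hH) =
        algEnt (endRestrict φ N hNi) + algEnt (endRestrict φ' H' hH') := by
      refine central_add (Subgroup.inclusion hNH) ((QuotientGroup.mk' N).subgroupMap H) _ _ _
        (Subgroup.inclusion_injective hNH) (MonoidHom.subgroupMap_surjective _ _) ?_
        (fun _ => rfl) (fun _ => rfl) ?_ (hlfS N) (hlfS H)
      · rintro ⟨x, hx⟩
        rw [← Subtype.coe_inj]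
        change QuotientGroup.mk' N x = 1 ↔ _
        rw [← MonoidHom.mem_ker, QuotientGroup.ker_mk']
        exact ⟨fun h => ⟨⟨x, h⟩, rfl⟩, by rintro ⟨y, hy⟩; obtain rfl : (y : G) = x := congrArg Subtype.val hy; exact y.2⟩
      · rintro ⟨y, hy⟩ ⟨x, hx⟩
        exact Subtype.ext (Subgroup.mem_center_iff.1 (hNc hy) x).symm
    rw [e1, e2, e3, add_assoc]

end AlgEntropy

/-- Main theorem: Addition Theorem for torsion nilpotent groups.
If `G` is a torsion nilpotent group, `φ` an endomorphism of `G` and `H` a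
`φ`-invariant normal subgroup, then `h(φ) = h(φ↾_H) + h(φ̄)`. -/
theorem AT_torsion_nilpotent {G : Type*} [Group G] (htor : Monoid.IsTorsion G)
    [Group.IsNilpotent G] (φ : G →* G) (H : Subgroup G) (hN : H.Normal)
    (hH : H ≤ H.comap φ) :
    AlgEntropy.AT φ H hN hH := by
  obtain ⟨n, hn⟩ := Subgroup.nilpotent_iff_lowerCentralSeries.1 (inferInstance : Group.IsNilpotent G)
  exact AlgEntropy.main_ind n G (G ⧸ H) htor φ (QuotientGroup.map H H φ hH) (QuotientGroup.mk' H)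
    (QuotientGroup.mk'_surjective _) (fun _ => rfl) H (QuotientGroup.ker_mk' H) hH
    (le_bot_iff.1 ((AlgEntropy.cser_le_lower H n).trans hn.le))
end

section
/- Let G be a locally finite group and let {G_i}_{i∈I} be a chain (a family totally ordered by inclusion) of subgroups of G with G = ⋃_{i∈I} G_i. Assume that each G_i is characteristic in G (stable under every automorphism of G) and that for every i ∈ I the Addition Theorem holds for G_i for automorphisms, i.e. AT(G_i, ψ, K) holds for every automorphism ψ of G_i and every ψ-stable normal subgroup K of G_i. Then the Addition Theorem holds for G for automorphisms: for every automorphism φ of G and every φ-stable normal subgroup H of G, h(φ) = h(φ↾_H) + h(φ̄), where φ̄ is the automorphism induced by φ on G/H. -/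
open scoped Pointwise ENNReal

namespace AlgEntropy

lemma entTraj_map {A B : Type*} [Group A] [Group B] (f : A →* B) (α : A →* A) (β : B →* B)
    (h : ∀ x, f (α x) = β (f x)) (F : Set A) (n : ℕ) :
    entTraj β (f '' F) n = f '' entTraj α F n := by
  have hit : ∀ (n : ℕ) (x : A), f ((⇑α)^[n] x) = (⇑β)^[n] (f x) := by
    intro n
    exact Function.Semiconj.iterate_right (f := ⇑f) h n
  induction n with
  | zero => simp [entTraj]
  | succ n ih =>
    simp only [entTraj]
    rw [ih, Set.image_mul, Set.image_image, Set.image_image]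
    simp only [hit]

lemma entH_map {A B : Type*} [Group A] [Group B] (f : A →* B) (hf : Function.Injective f)
    (α : A →* A) (β : B →* B) (h : ∀ x, f (α x) = β (f x)) (F : Subgroup A) :
    entH β (F.map f) = entH α F := by
  unfold entH
  simp only [Subgroup.coe_map, entTraj_map f α β h, Set.ncard_image_of_injective _ hf]

lemma algEnt_eq {A B : Type*} [Group A] [Group B] (f : A →* B) (hf : Function.Injective f)
    (α : A →* A) (β : B →* B) (h : ∀ x, f (α x) = β (f x)) :
    algEnt α = ⨆ (F : Subgroup B) (_ : (F : Set B).Finite) (_ : F ≤ f.range),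
      ENNReal.ofReal (entH β F) := by
  unfold algEnt
  apply le_antisymm
  · refine iSup₂_le fun F hF => ?_
    rw [← entH_map f hf α β h F]
    refine le_iSup_of_le (F.map f) (le_iSup_of_le ?_ (le_iSup_of_le ?_ le_rfl))
    · simpa using hF.image f
    · exact Subgroup.map_le_range f F
  · refine iSup_le fun F => iSup_le fun hF => iSup_le fun hr => ?_
    have hm : (F.comap f).map f = F := Subgroup.map_comap_eq_self hr
    rw [← hm, entH_map f hf α β h]
    refine le_iSup₂_of_le (F.comap f) ?_ le_rfl
    rw [Subgroup.coe_comap]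
    exact Set.Finite.preimage hf.injOn hF

lemma algEnt_mono {A A' B : Type*} [Group A] [Group A'] [Group B]
    (f : A →* B) (hf : Function.Injective f)
    (α : A →* A) (β : B →* B) (h : ∀ x, f (α x) = β (f x))
    (f' : A' →* B) (hf' : Function.Injective f')
    (α' : A' →* A') (h' : ∀ x, f' (α' x) = β (f' x)) (hr : f.range ≤ f'.range) :
    algEnt α ≤ algEnt α' := by
  rw [algEnt_eq f hf α β h, algEnt_eq f' hf' α' β h']
  exact iSup_mono fun F => iSup_mono fun hF => iSup_le fun hl =>
    le_iSup_of_le (hl.trans hr) le_rfl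

lemma algEnt_iSup {ι : Type*} [Nonempty ι] {A : ι → Type*} {B : Type*} [∀ i, Group (A i)] [Group B]
    (f : ∀ i, A i →* B) (hf : ∀ i, Function.Injective (f i))
    (α : ∀ i, A i →* A i) (β : B →* B) (h : ∀ i x, f i (α i x) = β (f i x))
    (hd : Directed (· ≤ ·) fun i => (f i).range)
    (hu : ∀ b, ∃ i, b ∈ (f i).range) :
    algEnt β = ⨆ i, algEnt (α i) := by
  apply le_antisymm
  · refine iSup₂_le fun F hF => ?_
    have key : ∃ i, (F : Set B) ⊆ (f i).range := by
      apply Set.Finite.induction_on_subset (motive := fun s _ => ∃ i, s ⊆ ((f i).range : Set B)) _ hF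
      · exact ⟨Classical.arbitrary ι, Set.empty_subset _⟩
      · rintro a s _ _ _ ⟨i, hi⟩
        obtain ⟨j, hj⟩ := hu a
        obtain ⟨k, hik, hjk⟩ := hd i j
        exact ⟨k, Set.insert_subset (hjk hj) (hi.trans hik)⟩
    obtain ⟨i, hi⟩ := key
    refine le_iSup_of_le i ?_
    rw [algEnt_eq (f i) (hf i) (α i) β (h i)]
    exact le_iSup_of_le F (le_iSup_of_le hF (le_iSup_of_le hi le_rfl))
  · refine iSup_le fun i => ?_
    rw [algEnt_eq (f i) (hf i) (α i) β (h i)]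
    exact iSup_mono fun F => iSup_mono fun hF => iSup_le fun _ => le_rfl

end AlgEntropy

/-- Reduction along chains, automorphisms. Let `G` be a locally
finite group which is the union of a chain of characteristic subgroups `G_i`.
If the Addition Theorem holds for each `G_i` for automorphisms, then it holds for `G`
for automorphisms. -/
theorem AT_of_chain_aut {G : Type*} [Group G] (hG : IsLocallyFinite G)
    {ι : Type*} (Gf : ι → Subgroup G)
    (hchain : ∀ i j, Gf i ≤ Gf j ∨ Gf j ≤ Gf i)
    (hunion : ∀ g : G, ∃ i, g ∈ Gf i)
    (hchar : ∀ (i : ι) (ψ : G ≃* G) (x : G), ψ x ∈ Gf i ↔ x ∈ Gf i)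
    (hATi : ∀ (i : ι) (ψ : ↥(Gf i) ≃* ↥(Gf i)) (K : Subgroup ↥(Gf i))
      (hK : K.Normal) (hst : ∀ x, ψ x ∈ K ↔ x ∈ K),
      AlgEntropy.AT ψ.toMonoidHom K hK
        (fun x hx => Subgroup.mem_comap.mpr ((hst x).mpr hx)))
    (φ : G ≃* G) (H : Subgroup G) (hN : H.Normal)
    (hst : ∀ x : G, φ x ∈ H ↔ x ∈ H) :
    AlgEntropy.AT φ.toMonoidHom H hN
      (fun x hx => Subgroup.mem_comap.mpr ((hst x).mpr hx)) := by
  classical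
  haveI : Nonempty ι := ⟨(hunion 1).choose⟩
  have hH : H ≤ H.comap φ.toMonoidHom := fun x hx => Subgroup.mem_comap.mpr ((hst x).mpr hx)
  -- restrictions of `φ` to the members of the chain
  let ψ : ∀ i, ↥(Gf i) ≃* ↥(Gf i) := fun i =>
    { toFun := fun x => ⟨φ x, (hchar i φ x).mpr x.2⟩
      invFun := fun x => ⟨φ.symm x, (hchar i φ.symm x).mpr x.2⟩
      left_inv := fun x => by simp
      right_inv := fun x => by simp
      map_mul' := fun x y => by ext; simp }
  have hψ : ∀ i (x : Gf i), ((ψ i x : Gf i) : G) = φ x := fun i x => rfl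
  let K : ∀ i, Subgroup ↥(Gf i) := fun i => H.subgroupOf (Gf i)
  haveI hK : ∀ i, (K i).Normal := fun i => inferInstanceAs (H.subgroupOf (Gf i)).Normal
  have hKst : ∀ i x, ψ i x ∈ K i ↔ x ∈ K i := fun i x => by
    simp only [K, Subgroup.mem_subgroupOf, hψ, hst]
  have hKle : ∀ i, K i ≤ (K i).comap (ψ i).toMonoidHom := fun i x hx =>
    Subgroup.mem_comap.mpr ((hKst i x).mpr hx)
  have hAT := fun i => hATi i (ψ i) (K i) (hK i) (hKst i)
  have hdir : ∀ i j, ∃ k, Gf i ≤ Gf k ∧ Gf j ≤ Gf k := fun i j =>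
    (hchain i j).elim (fun h => ⟨j, h, le_rfl⟩) (fun h => ⟨i, le_rfl, h⟩)
  -- the three families of embeddings
  let f2 : ∀ i, ↥(K i) →* ↥H := fun i =>
    ((Gf i).subtype.comp (K i).subtype).codRestrict H (fun x => x.2)
  let f3 : ∀ i, (↥(Gf i) ⧸ K i) →* G ⧸ H := fun i =>
    QuotientGroup.map (K i) H (Gf i).subtype le_rfl
  have h1 : ∀ i, Function.Injective (Gf i).subtype := fun i => Subtype.val_injective
  have h2 : ∀ i, Function.Injective (f2 i) := fun i x y hxy =>
    Subtype.ext (Subtype.ext (congrArg (fun z : H => (z : G)) hxy))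
  have h3 : ∀ i, Function.Injective (f3 i) := fun i => by
    rw [injective_iff_map_eq_one]
    intro x
    induction x using QuotientGroup.induction_on with
    | H x =>
      intro hx
      have hx' : ((x : G) : G ⧸ H) = 1 := hx
      rw [QuotientGroup.eq_one_iff] at hx' ⊢
      exact hx'
  have r2 : ∀ i (y : H), y ∈ (f2 i).range ↔ (y : G) ∈ Gf i := fun i y => by
    constructor
    · rintro ⟨x, rfl⟩
      exact x.1.2
    · intro hy
      exact ⟨⟨⟨y, hy⟩, y.2⟩, rfl⟩
  have m3 : ∀ i j, Gf i ≤ Gf j → (f3 i).range ≤ (f3 j).range := by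
    rintro i j hij _ ⟨x, rfl⟩
    induction x using QuotientGroup.induction_on with
    | H x => exact ⟨((⟨x, hij x.2⟩ : Gf j) : ↥(Gf j) ⧸ K j), rfl⟩
  have m2 : ∀ i j, Gf i ≤ Gf j → (f2 i).range ≤ (f2 j).range := fun i j hij y hy =>
    (r2 j y).mpr (hij ((r2 i y).mp hy))
  have c2 : ∀ i x, f2 i (AlgEntropy.endRestrict (ψ i).toMonoidHom (K i) (hKle i) x)
      = AlgEntropy.endRestrict φ.toMonoidHom H hH (f2 i x) := fun i x => rfl
  have c3 : ∀ i x, f3 i (QuotientGroup.map (K i) (K i) (ψ i).toMonoidHom (hKle i) x)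
      = QuotientGroup.map H H φ.toMonoidHom hH (f3 i x) := fun i x => by
    induction x using QuotientGroup.induction_on with
    | H x => rfl
  have e1 : AlgEntropy.algEnt φ.toMonoidHom = ⨆ i, AlgEntropy.algEnt (ψ i).toMonoidHom := by
    refine AlgEntropy.algEnt_iSup (fun i => (Gf i).subtype) h1 _ _ (fun i x => rfl) ?_ ?_
    · intro i j
      simpa using hdir i j
    · simpa using hunion
  have e2 := AlgEntropy.algEnt_iSup f2 h2 _ _ c2
    (fun i j => (hdir i j).imp fun k hk => ⟨m2 i k hk.1, m2 j k hk.2⟩)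
    (fun b => (hunion b).imp fun i hi => (r2 i b).mpr hi)
  have e3 := AlgEntropy.algEnt_iSup f3 h3 _ _ c3
    (fun i j => (hdir i j).imp fun k hk => ⟨m3 i k hk.1, m3 j k hk.2⟩)
    (fun b => by
      induction b using QuotientGroup.induction_on with
      | H b =>
        obtain ⟨i, hi⟩ := hunion b
        exact ⟨i, ((⟨b, hi⟩ : Gf i) : ↥(Gf i) ⧸ K i), rfl⟩)
  show AlgEntropy.algEnt φ.toMonoidHom =
    AlgEntropy.algEnt (AlgEntropy.endRestrict φ.toMonoidHom H hH) +
      AlgEntropy.algEnt (QuotientGroup.map H H φ.toMonoidHom hH)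
  rw [e1, e2, e3, ENNReal.iSup_add_iSup]
  · exact iSup_congr hAT
  · intro i j
    obtain ⟨k, hik, hjk⟩ := hdir i j
    exact ⟨k, add_le_add
      (AlgEntropy.algEnt_mono (f2 i) (h2 i) _ _ (c2 i) (f2 k) (h2 k) _ (c2 k) (m2 i k hik))
      (AlgEntropy.algEnt_mono (f3 j) (h3 j) _ _ (c3 j) (f3 k) (h3 k) _ (c3 k) (m3 j k hjk))⟩
end
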